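/- arXiv:1601.00333 — 2 statements merged into one kernel-verified Lean document; each statement's English description precedes it below -/
import Mathlib

section
/- Let K be a group, N a normal subgroup of K, B a subgroup of K, and χ : B → ℂ^× a homomorphism. Let V_χ = {f : K → ℂ | f(bg) = χ(b) f(g) for all b ∈ B, g ∈ K}, with K acting by right translation. If the restriction of χ to B ∩ N is nontrivial, then the space of N-fixed vectors V_χ^N is zero. If the restriction of χ to B ∩ N is trivial, then χ extends uniquely to a homomorphism χ̃ : BN → ℂ^× that is trivial on N, and V_χ^N = V_χ̃ := {f : K → ℂ | f(hg) = χ̃(h) f(g) for all h ∈ BN, g ∈ K}. -/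
noncomputable section

def indV (K : Type) [Group K] (B : Subgroup K) (χ : B →* ℂˣ) : Submodule ℂ (K → ℂ) where
  carrier := {f | ∀ (b : B) (g : K), f (↑b * g) = (χ b : ℂ) * f g}
  add_mem' := by
    intro f g hf hg b h
    simp only [Pi.add_apply, hf b h, hg b h]
    ring
  zero_mem' := by intro b h; simp
  smul_mem' := by
    intro c f hf b h
    simp only [Pi.smul_apply, smul_eq_mul, hf b h]
    ring

/-- Every element of `B ⊔ N`, with `N` normal, is congruent modulo `N` to an element of `B`. -/
theorem exists_inv_mul_mem_of_mem_sup {K : Type*} [Group K] {B N : Subgroup K} [N.Normal] {x : K}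
    (hx : x ∈ B ⊔ N) : ∃ b : B, (b : K)⁻¹ * x ∈ N := by
  obtain ⟨b, hb, n, hn, rfl⟩ := Subgroup.mem_sup_of_normal_right.1 hx
  exact ⟨⟨b, hb⟩, by simpa using hn⟩

/-- A homomorphism on `B` that is trivial on `B ⊓ N`, with `N` normal, extends to `B ⊔ N` with
value at `x` its value at any element of `B` congruent to `x` modulo `N`. -/
theorem exists_extension_sup {K M : Type*} [Group K] [Group M] {B N : Subgroup K} [N.Normal]
    (χ : B →* M) (h : ∀ b : B, (b : K) ∈ N → χ b = 1) :
    ∃ χt : ↥(B ⊔ N) →* M, ∀ (b : B) (x : ↥(B ⊔ N)), (b : K)⁻¹ * x ∈ N → χt x = χ b := by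
  choose β hβ using fun x : ↥(B ⊔ N) => exists_inv_mul_mem_of_mem_sup x.2
  have key (b : B) (x : ↥(B ⊔ N)) (hx : (b : K)⁻¹ * x ∈ N) : χ (β x) = χ b := by
    have hmem : (((β x)⁻¹ * b : B) : K) ∈ N := by
      have := N.mul_mem (hβ x) (N.inv_mem hx)
      simpa [mul_assoc] using this
    have := h _ hmem
    rwa [map_mul, map_inv, inv_mul_eq_one] at this
  refine ⟨MonoidHom.mk' (fun x => χ (β x)) fun x y => ?_, key⟩
  rw [← map_mul]
  apply key
  have hconj := Subgroup.Normal.conj_mem' ‹N.Normal› _ (hβ x) (β y : K)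
  have := N.mul_mem hconj (hβ y)
  simpa [mul_assoc] using this

/-- **Statement 13.** Let `K` be a group, `N` a normal subgroup, `B` a subgroup and
`χ : B → ℂˣ` a homomorphism, and let `V_χ` (with the right-translation action of `K`) be as
above. If `χ` is nontrivial on `B ∩ N` then the space of `N`-fixed vectors of `V_χ` is zero.
If `χ` is trivial on `B ∩ N`, then `χ` extends uniquely to a homomorphism
`χ̃ : BN → ℂˣ` trivial on `N`, and `V_χ^N = V_χ̃`. -/
theorem fixed_vectors_of_induced (K : Type) [Group K] (N : Subgroup K) [N.Normal] (B : Subgroup K)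
    (χ : B →* ℂˣ) :
    ((∃ b : B, (b : K) ∈ N ∧ χ b ≠ 1) →
      ∀ f ∈ indV K B χ, (∀ ν ∈ N, (fun x => f (x * ν)) = f) → f = 0) ∧
    ((∀ b : B, (b : K) ∈ N → χ b = 1) →
      ∃ χt : ↥(B ⊔ N) →* ℂˣ,
        ((∀ b : B, χt ⟨↑b, (le_sup_left : B ≤ B ⊔ N) b.2⟩ = χ b) ∧
         (∀ (x : K) (hx : x ∈ N), χt ⟨x, (le_sup_right : N ≤ B ⊔ N) hx⟩ = 1)) ∧
        (∀ χt' : ↥(B ⊔ N) →* ℂˣ,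
          ((∀ b : B, χt' ⟨↑b, (le_sup_left : B ≤ B ⊔ N) b.2⟩ = χ b) ∧
           (∀ (x : K) (hx : x ∈ N), χt' ⟨x, (le_sup_right : N ≤ B ⊔ N) hx⟩ = 1)) → χt' = χt) ∧
        (∀ f : K → ℂ,
          (f ∈ indV K B χ ∧ ∀ ν ∈ N, (fun x => f (x * ν)) = f) ↔
          f ∈ indV K (B ⊔ N) χt)) := by
  refine ⟨?_, fun h => ?_⟩
  · rintro ⟨b, hbN, hb⟩ f hf hfix
    funext g
    have h₁ := congrFun (hfix _ (Subgroup.Normal.conj_mem' ‹N.Normal› _ hbN g)) g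
    have h₂ : f (b * g) = f g := by simpa [mul_assoc] using h₁
    rw [hf b g] at h₂
    by_contra hg
    exact hb (Units.ext (mul_right_cancel₀ hg (h₂.trans (one_mul _).symm)))
  · obtain ⟨χt, hχt⟩ := exists_extension_sup χ h
    have hB (b : B) : χt ⟨↑b, (le_sup_left : B ≤ B ⊔ N) b.2⟩ = χ b :=
      hχt b _ (by simp)
    have hN (x : K) (hx : x ∈ N) : χt ⟨x, (le_sup_right : N ≤ B ⊔ N) hx⟩ = 1 :=
      (hχt 1 _ (by simpa using hx)).trans χ.map_one
    refine ⟨χt, ⟨hB, hN⟩, ?_, fun f => ⟨?_, fun hf => ⟨fun b g => ?_, fun ν hν => ?_⟩⟩⟩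
    · rintro χt' ⟨hB', hN'⟩
      ext1 x
      obtain ⟨b, hb⟩ := exists_inv_mul_mem_of_mem_sup x.2
      have hx : x = ⟨↑b, (le_sup_left : B ≤ B ⊔ N) b.2⟩ *
          ⟨(b : K)⁻¹ * x, (le_sup_right : N ≤ B ⊔ N) hb⟩ := Subtype.ext (by simp)
      rw [hx, map_mul, map_mul, hB', hN' _ hb, hB, hN _ hb]
    · rintro ⟨hf, hfix⟩ x g
      obtain ⟨b, hb⟩ := exists_inv_mul_mem_of_mem_sup x.2
      rw [hχt b x hb, ← hf b g]
      have h₁ := congrFun (hfix _ (Subgroup.Normal.conj_mem' ‹N.Normal› _ hb g)) (b * g)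
      simpa [mul_assoc] using h₁
    · rw [← hB b]
      exact hf ⟨b, _⟩ g
    · funext x
      have hmem := Subgroup.Normal.conj_mem ‹N.Normal› _ hν x
      have h₁ := hf ⟨_, (le_sup_right : N ≤ B ⊔ N) hmem⟩ x
      rw [hN _ hmem] at h₁
      simpa using h₁
end
end

section
/- Let K be a group, B a subgroup of finite index in K, and χ, ψ : B → ℂ^× homomorphisms. Let V_χ = {f : K → ℂ | f(bg) = χ(b)f(g) for all b ∈ B, g ∈ K} and V_ψ likewise, with K acting by right translation, and define the Hecke space H(χ,ψ) = {f : K → ℂ | f(b g b') = χ(b) f(g) ψ(b') for all b, b' ∈ B, g ∈ K}. Then dim_ℂ Hom_{ℂ[K]}(V_χ, V_ψ) = dim_ℂ H(χ,ψ), and this common dimension equals the number of double cosets BxB in B\K/B such that χ(g) = ψ(xgx^{-1}) for all g ∈ B with xgx^{-1} ∈ B. -/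
set_option synthInstance.maxHeartbeats 1000000
set_option maxHeartbeats 1000000

noncomputable section

/-- right translation, as a linear endomorphism of `K → ℂ` -/
def rtrans (K : Type) [Group K] (k : K) : (K → ℂ) →ₗ[ℂ] (K → ℂ) where
  toFun f := fun x => f (x * k)
  map_add' := by intros; rfl
  map_smul' := by intros; rfl

lemma rtrans_mem (K : Type) [Group K] (B : Subgroup K) (χ : B →* ℂˣ) (k : K)
    (f : K → ℂ) (hf : f ∈ indV K B χ) : rtrans K k f ∈ indV K B χ := by
  intro b h
  simpa [rtrans, mul_assoc] using hf b (h * k)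

/-- right translation restricted to the induced representation -/
def rtransInd (K : Type) [Group K] (B : Subgroup K) (χ : B →* ℂˣ) (k : K) :
    ↥(indV K B χ) →ₗ[ℂ] ↥(indV K B χ) :=
  (rtrans K k).restrict (fun f hf => rtrans_mem K B χ k f hf)

/-- the space `Hom_{ℂ[K]}` of `K`-equivariant `ℂ`-linear maps between two induced
representations, realized as a submodule of the space of all functions -/
def homK (K : Type) [Group K] (B : Subgroup K) (χ ψ : B →* ℂˣ) :
    Submodule ℂ (↥(indV K B χ) → ↥(indV K B ψ)) where
  carrier := {T | (∀ (c : ℂ) (f g : ↥(indV K B χ)), T (c • f + g) = c • T f + T g) ∧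
    ∀ (k : K) (f : ↥(indV K B χ)), T (rtransInd K B χ k f) = rtransInd K B ψ k (T f)}
  add_mem' := by
    rintro S T ⟨hS1, hS2⟩ ⟨hT1, hT2⟩
    refine ⟨fun c f g => ?_, fun k f => ?_⟩
    · simp only [Pi.add_apply, hS1 c f g, hT1 c f g, smul_add]
      abel
    · simp only [Pi.add_apply, hS2 k f, hT2 k f]
      rw [map_add]
  zero_mem' := by
    refine ⟨fun c f g => ?_, fun k f => ?_⟩ <;> simp
  smul_mem' := by
    rintro c T ⟨hT1, hT2⟩
    refine ⟨fun a f g => ?_, fun k f => ?_⟩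
    · simp only [Pi.smul_apply, hT1 a f g, smul_add, smul_comm c a]
    · simp only [Pi.smul_apply, hT2 k f, map_smul]

/-- the Hecke space `H(χ, ψ)` -/
def hecke (K : Type) [Group K] (B : Subgroup K) (χ ψ : B →* ℂˣ) :
    Submodule ℂ (K → ℂ) where
  carrier := {f | ∀ (b b' : B) (g : K), f (↑b * g * ↑b') = (χ b : ℂ) * f g * (ψ b' : ℂ)}
  add_mem' := by
    intro f g hf hg b b' x
    simp only [Pi.add_apply, hf b b' x, hg b b' x]
    ring
  zero_mem' := by intro b b' x; simp
  smul_mem' := by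
    intro c f hf b b' x
    simp only [Pi.smul_apply, smul_eq_mul, hf b b' x]
    ring

section IntertwinerHecke

variable {K : Type} [Group K] {B : Subgroup K} {χ ψ : B →* ℂˣ}

lemma char_inv_mul_char (χ : B →* ℂˣ) (b : B) : (χ b⁻¹ : ℂ) * (χ b : ℂ) = 1 := by
  rw [← Units.val_mul, ← map_mul]
  simp

section CosetSums

variable {F : K → ℂ}

/-- The function on `K ⧸ B` induced by a right `B`-invariant function on `K`. -/
def cosetLift (F : K → ℂ) (hF : ∀ (u : K) (b : B), F (u * b) = F u) : K ⧸ B → ℂ :=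
  Quotient.lift F fun u v huv => by
    have := hF u ⟨u⁻¹ * v, QuotientGroup.leftRel_apply.mp huv⟩
    simpa using this.symm

lemma cosetLift_mk (hF : ∀ (u : K) (b : B), F (u * b) = F u) (u : K) :
    cosetLift F hF (u : K ⧸ B) = F u := rfl

lemma cosetLift_out (hF : ∀ (u : K) (b : B), F (u * b) = F u) (q : K ⧸ B) :
    cosetLift F hF q = F q.out := by
  conv_lhs => rw [← QuotientGroup.out_eq' q]
  rfl

lemma sum_out_mul_left [Fintype (K ⧸ B)] (hF : ∀ (u : K) (b : B), F (u * b) = F u) (k : K) :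
    ∑ q : K ⧸ B, F (k * q.out) = ∑ q : K ⧸ B, F q.out := by
  simp_rw [← cosetLift_out hF]
  rw [← Equiv.sum_comp (MulAction.toPerm k) (cosetLift F hF)]
  refine Finset.sum_congr rfl fun q _ => ?_
  rw [← cosetLift_mk hF, MulAction.toPerm_apply]
  conv_rhs => rw [← QuotientGroup.out_eq' q]
  rfl

lemma sum_out_eq_of_support [Fintype (K ⧸ B)] (hF : ∀ (u : K) (b : B), F (u * b) = F u) (v : K)
    (hv : ∀ u, v⁻¹ * u ∉ B → F u = 0) : ∑ q : K ⧸ B, F q.out = F v := by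
  simp_rw [← cosetLift_out hF]
  rw [Finset.sum_eq_single (v : K ⧸ B), cosetLift_mk]
  · intro q _ hq
    rw [cosetLift_out]
    refine hv _ fun h => hq ?_
    rw [← QuotientGroup.out_eq' q]
    exact (QuotientGroup.eq.mpr h).symm
  · simp

end CosetSums

open Classical in
/-- The function on `K` extending `χ` by zero. -/
def charExtend (χ : B →* ℂˣ) (g : K) : ℂ := if h : g ∈ B then (χ ⟨g, h⟩ : ℂ) else 0

lemma charExtend_coe (χ : B →* ℂˣ) (b : B) : charExtend χ b = χ b := by
  simp [charExtend]

lemma charExtend_one (χ : B →* ℂˣ) : charExtend χ 1 = 1 := by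
  simpa using charExtend_coe χ 1

lemma charExtend_of_notMem (χ : B →* ℂˣ) {g : K} (h : g ∉ B) : charExtend χ g = 0 := by
  simp [charExtend, h]

lemma charExtend_coe_mul (χ : B →* ℂˣ) (b : B) (g : K) :
    charExtend χ (b * g) = χ b * charExtend χ g := by
  by_cases h : g ∈ B
  · lift g to B using h
    rw [← Subgroup.coe_mul, charExtend_coe, charExtend_coe, map_mul, Units.val_mul]
  · rw [charExtend_of_notMem χ h,
      charExtend_of_notMem χ (by rwa [B.mul_mem_cancel_left b.2]), mul_zero]

lemma charExtend_mul_coe (χ : B →* ℂˣ) (g : K) (b : B) :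
    charExtend χ (g * b) = charExtend χ g * χ b := by
  by_cases h : g ∈ B
  · lift g to B using h
    rw [← Subgroup.coe_mul, charExtend_coe, charExtend_coe, map_mul, Units.val_mul]
  · rw [charExtend_of_notMem χ h,
      charExtend_of_notMem χ (by rwa [B.mul_mem_cancel_right b.2]), zero_mul]

/-- The generator of the induced representation: `χ` extended by zero. -/
def indGen (χ : B →* ℂˣ) : indV K B χ := ⟨charExtend χ, charExtend_coe_mul χ⟩

lemma rtransInd_apply (k : K) (f : indV K B χ) (g : K) :
    (rtransInd K B χ k f : K → ℂ) g = (f : K → ℂ) (g * k) := rfl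

lemma rtransInd_indGen (b : B) :
    rtransInd K B χ b (indGen χ) = (χ b : ℂ) • indGen χ := by
  ext g
  change charExtend χ (g * b) = χ b * charExtend χ g
  rw [charExtend_mul_coe, mul_comm]

lemma eq_sum_rtransInd_indGen [Fintype (K ⧸ B)] (f : indV K B χ) :
    f = ∑ q : K ⧸ B, (f : K → ℂ) q.out⁻¹ • rtransInd K B χ q.out (indGen χ) := by
  ext g
  rw [AddSubmonoidClass.coe_finsetSum, Finset.sum_apply]
  change (f : K → ℂ) g = ∑ q : K ⧸ B, (f : K → ℂ) q.out⁻¹ * charExtend χ (g * q.out)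
  rw [sum_out_eq_of_support (F := fun u => (f : K → ℂ) u⁻¹ * charExtend χ (g * u)) _ g⁻¹]
  · simp [charExtend_one]
  · intro u hu
    rw [inv_inv] at hu
    simp [charExtend_of_notMem χ hu]
  · intro u b
    rw [mul_inv_rev, ← mul_assoc, charExtend_mul_coe, ← Subgroup.coe_inv, f.2]
    linear_combination (f : K → ℂ) u⁻¹ * charExtend χ (g * u) * char_inv_mul_char χ b

/-- An element of `homK` as a linear map. -/
def homKToLinearMap (T : homK K B χ ψ) : indV K B χ →ₗ[ℂ] indV K B ψ :=
  IsLinearMap.mk' T.1 (by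
    have h0 : T.1 0 = 0 := by simpa using T.2.1 (-1) 0 0
    exact ⟨fun f g => by simpa using T.2.1 1 f g, fun c f => by simpa [h0] using T.2.1 c f 0⟩)

lemma homKToLinearMap_apply (T : homK K B χ ψ) (f : indV K B χ) :
    homKToLinearMap T f = T.1 f := rfl

/-- Evaluation of an intertwiner at the generator `indGen χ`. -/
def homKToHecke (χ ψ : B →* ℂˣ) : homK K B χ ψ →ₗ[ℂ] hecke K B ψ χ where
  toFun T := ⟨T.1 (indGen χ), fun b b' g => by
    have h := T.2.2 b' (indGen χ)
    rw [rtransInd_indGen, ← homKToLinearMap_apply, ← homKToLinearMap_apply, map_smul] at h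
    have h' := congrArg (fun f : indV K B ψ => (f : K → ℂ) g) h
    change (χ b' : ℂ) * (T.1 (indGen χ) : K → ℂ) g = (T.1 (indGen χ) : K → ℂ) (g * b') at h'
    rw [mul_assoc, (T.1 (indGen χ)).2, ← h']
    ring⟩
  map_add' _ _ := rfl
  map_smul' _ _ := rfl

lemma homKToHecke_injective [Fintype (K ⧸ B)] : Function.Injective (homKToHecke χ ψ) := by
  refine (injective_iff_map_eq_zero _).mpr fun T hT => ?_
  have h0 : homKToLinearMap T (indGen χ) = 0 := Subtype.ext (congrArg Subtype.val hT :)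
  refine Subtype.ext (funext fun f => ?_)
  change homKToLinearMap T f = 0
  rw [eq_sum_rtransInd_indGen f, map_sum]
  refine Finset.sum_eq_zero fun q _ => ?_
  rw [map_smul, homKToLinearMap_apply, T.2.2, ← homKToLinearMap_apply, h0, map_zero, smul_zero]

lemma hecke_kernel_invariant (Φ : hecke K B ψ χ) (f : indV K B χ) (g h u : K) (b : B) :
    (Φ : K → ℂ) (g * (u * b)) * (f : K → ℂ) ((u * b)⁻¹ * h) =
      (Φ : K → ℂ) (g * u) * (f : K → ℂ) (u⁻¹ * h) := by
  have h1 := Φ.2 1 b (g * u)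
  rw [map_one, Units.val_one, one_mul, Subgroup.coe_one, one_mul] at h1
  rw [← mul_assoc, h1, mul_inv_rev, mul_assoc, mul_assoc (b : K)⁻¹, ← Subgroup.coe_inv, f.2]
  linear_combination
    (Φ : K → ℂ) (g * u) * (f : K → ℂ) (u⁻¹ * h) * char_inv_mul_char χ b

/-- The intertwiner given by convolution with an element of the Hecke space. -/
def heckeToHomK [Fintype (K ⧸ B)] (Φ : hecke K B ψ χ) : homK K B χ ψ :=
  ⟨fun f => ⟨fun g => ∑ q : K ⧸ B, (Φ : K → ℂ) (g * q.out) * (f : K → ℂ) q.out⁻¹, by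
      intro b g
      rw [Finset.mul_sum]
      refine Finset.sum_congr rfl fun q _ => ?_
      have h1 := Φ.2 b 1 (g * q.out)
      rw [map_one, Units.val_one, mul_one, Subgroup.coe_one, mul_one] at h1
      rw [mul_assoc, h1, mul_assoc]⟩, by
    refine ⟨fun c f f' => ?_, fun k f => ?_⟩
    · ext g
      change ∑ q : K ⧸ B, (Φ : K → ℂ) (g * q.out) *
          (c * (f : K → ℂ) q.out⁻¹ + (f' : K → ℂ) q.out⁻¹) =
        c * ∑ q : K ⧸ B, (Φ : K → ℂ) (g * q.out) * (f : K → ℂ) q.out⁻¹ +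
          ∑ q : K ⧸ B, (Φ : K → ℂ) (g * q.out) * (f' : K → ℂ) q.out⁻¹
      rw [Finset.mul_sum, ← Finset.sum_add_distrib]
      exact Finset.sum_congr rfl fun q _ => by ring
    · ext g
      change ∑ q : K ⧸ B, (Φ : K → ℂ) (g * q.out) * (f : K → ℂ) (q.out⁻¹ * k) =
        ∑ q : K ⧸ B, (Φ : K → ℂ) (g * k * q.out) * (f : K → ℂ) q.out⁻¹
      rw [← sum_out_mul_left
        (F := fun u => (Φ : K → ℂ) (g * u) * (f : K → ℂ) (u⁻¹ * k))
        (hecke_kernel_invariant Φ f g k) k]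
      refine Finset.sum_congr rfl fun q _ => ?_
      rw [← mul_assoc, mul_inv_rev, inv_mul_cancel_right]⟩

lemma homKToHecke_heckeToHomK [Fintype (K ⧸ B)] (Φ : hecke K B ψ χ) :
    homKToHecke χ ψ (heckeToHomK Φ) = Φ := by
  ext g
  change ∑ q : K ⧸ B, (Φ : K → ℂ) (g * q.out) * charExtend χ q.out⁻¹ = (Φ : K → ℂ) g
  have hF := hecke_kernel_invariant Φ (indGen χ) g 1
  simp only [mul_one] at hF
  refine (sum_out_eq_of_support
    (F := fun u => (Φ : K → ℂ) (g * u) * charExtend χ u⁻¹) hF 1 fun u hu => ?_).trans ?_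
  · rw [inv_one, one_mul, ← B.inv_mem_iff] at hu
    exact mul_eq_zero_of_right _ (charExtend_of_notMem χ hu)
  · rw [inv_one, mul_one]
    exact (congrArg _ (charExtend_one χ)).trans (mul_one _)

/-- Intertwiners `V_χ → V_ψ` are the same as elements of `H(ψ, χ)`. -/
def homKEquivHecke [Fintype (K ⧸ B)] (χ ψ : B →* ℂˣ) : homK K B χ ψ ≃ₗ[ℂ] hecke K B ψ χ :=
  LinearEquiv.ofBijective (homKToHecke χ ψ)
    ⟨homKToHecke_injective, fun Φ => ⟨heckeToHomK Φ, homKToHecke_heckeToHomK Φ⟩⟩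

/-- The double coset `BxB`. -/
def bicoset (B : Subgroup K) (x : K) : Set K := {y | ∃ b b' : B, y = b * x * b'}

lemma mem_bicoset_self (x : K) : x ∈ bicoset B x := ⟨1, 1, by simp⟩

lemma bicoset_subset_of_mem {x y : K} (h : y ∈ bicoset B x) : bicoset B y ⊆ bicoset B x := by
  obtain ⟨b, b', rfl⟩ := h
  rintro _ ⟨c, c', rfl⟩
  exact ⟨c * b, b' * c', by simp [mul_assoc]⟩

lemma mem_bicoset_symm {x y : K} (h : y ∈ bicoset B x) : x ∈ bicoset B y := by
  obtain ⟨b, b', rfl⟩ := h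
  exact ⟨b⁻¹, b'⁻¹, by simp [mul_assoc]⟩

lemma bicoset_eq_of_mem {x y : K} (h : y ∈ bicoset B x) : bicoset B y = bicoset B x :=
  (bicoset_subset_of_mem h).antisymm (bicoset_subset_of_mem (mem_bicoset_symm h))

lemma inv_bicoset (x : K) : (bicoset B x)⁻¹ = bicoset B x⁻¹ := by
  ext y
  rw [Set.mem_inv]
  constructor
  · rintro ⟨b, b', h⟩
    exact ⟨b'⁻¹, b⁻¹, by rw [← inv_inj, h]; simp [mul_assoc]⟩
  · rintro ⟨b, b', rfl⟩
    exact ⟨b'⁻¹, b⁻¹, by simp [mul_assoc]⟩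

/-- The double coset of `x` can support a nonzero element of `H(χ, ψ)`. -/
def Supports (χ ψ : B →* ℂˣ) (x : K) : Prop :=
  ∀ b b' : B, (b : K) * x * b' = x → χ b * ψ b' = 1

/-- The double cosets supporting nonzero elements of `H(χ, ψ)`. -/
def supportingBicosets (χ ψ : B →* ℂˣ) : Set (Set K) :=
  {s | ∃ x, Supports χ ψ x ∧ s = bicoset B x}

lemma Supports.inv {x : K} (h : Supports χ ψ x) : Supports ψ χ x⁻¹ := by
  intro b b' hb
  rw [mul_comm]
  refine h b' b ?_
  have : x⁻¹ = (b : K)⁻¹ * x⁻¹ * (b' : K)⁻¹ := by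
    rw [eq_mul_inv_iff_mul_eq, eq_inv_mul_iff_mul_eq, ← mul_assoc, hb]
  rw [← inv_inj]
  simpa [mul_assoc] using this.symm

lemma supports_iff_conj {x : K} : Supports ψ χ x ↔
    ∀ (g : K) (hg : g ∈ B) (hx : x * g * x⁻¹ ∈ B), χ ⟨g, hg⟩ = ψ ⟨x * g * x⁻¹, hx⟩ := by
  constructor
  · intro h g hg hx
    have := h ⟨x * g * x⁻¹, hx⟩ ⟨g, hg⟩⁻¹ (by simp [mul_assoc])
    rw [map_inv, mul_inv_eq_one] at this
    exact this.symm
  · intro h b b' hb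
    have hb' : x * (b'⁻¹ : B) * x⁻¹ = b := by
      rw [mul_inv_eq_iff_eq_mul, Subgroup.coe_inv, mul_inv_eq_iff_eq_mul, hb]
    have := h (b'⁻¹ : B) (b'⁻¹).2 (hb' ▸ b.2)
    simp only [hb', Subtype.coe_eta, map_inv] at this
    rw [← this, inv_mul_cancel]

lemma inv_mem_supportingBicosets {s : Set K} (hs : s ∈ supportingBicosets χ ψ) :
    s⁻¹ ∈ supportingBicosets ψ χ := by
  obtain ⟨x, hx, rfl⟩ := hs
  exact ⟨x⁻¹, hx.inv, inv_bicoset x⟩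

lemma card_supportingBicosets_comm (χ ψ : B →* ℂˣ) :
    Nat.card (supportingBicosets χ ψ) = Nat.card (supportingBicosets ψ χ) :=
  Nat.card_congr
    { toFun := fun s => ⟨_, inv_mem_supportingBicosets s.2⟩
      invFun := fun s => ⟨_, inv_mem_supportingBicosets s.2⟩
      left_inv := fun s => Subtype.ext (inv_inv s.1)
      right_inv := fun s => Subtype.ext (inv_inv s.1) }

lemma finite_supportingBicosets [Finite (K ⧸ B)] (χ ψ : B →* ℂˣ) :
    Finite (supportingBicosets χ ψ) := by
  refine ((Set.finite_range fun q : K ⧸ B => bicoset B q.out).subset ?_).to_subtype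
  rintro _ ⟨x, -, rfl⟩
  obtain ⟨b, hb⟩ := QuotientGroup.mk_out_eq_mul B x
  exact ⟨(x : K ⧸ B), bicoset_eq_of_mem ⟨1, b, by simp [hb]⟩⟩

lemma Supports.char_mul_char_eq {x : K} (hx : Supports χ ψ x) {b b' c c' : B}
    (h : (b : K) * x * b' = c * x * c') : χ b * ψ b' = χ c * ψ c' := by
  have key := hx (c⁻¹ * b) (b' * c'⁻¹) (by
    have : ((c⁻¹ * b : B) : K) * x * (b' * c'⁻¹ : B) = (c : K)⁻¹ * (b * x * b') * (c' : K)⁻¹ := by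
      simp [mul_assoc]
    rw [this, h]
    simp [mul_assoc])
  rw [map_mul, map_mul, map_inv, map_inv] at key
  calc χ b * ψ b' = χ c * ψ c' * ((χ c)⁻¹ * χ b * (ψ b' * (ψ c')⁻¹)) := by
        rw [mul_comm (ψ b'), mul_mul_mul_comm (χ c), mul_inv_cancel_left, mul_inv_cancel_left]
    _ = χ c * ψ c' := by rw [key, mul_one]

open Classical in
lemma Supports.exists_hecke {x : K} (hx : Supports χ ψ x) :
    ∃ f ∈ hecke K B χ ψ, f x = 1 ∧ ∀ y ∉ bicoset B x, f y = 0 := by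
  let f : K → ℂ := fun y =>
    if h : ∃ p : B × B, y = p.1 * x * p.2 then (χ h.choose.1 * ψ h.choose.2 : ℂˣ) else 0
  have hf : ∀ b b' : B, f (b * x * b') = (χ b * ψ b' : ℂˣ) := by
    intro b b'
    have h : ∃ p : B × B, (b : K) * x * b' = p.1 * x * p.2 := ⟨(b, b'), rfl⟩
    simp only [f, dif_pos h]
    rw [hx.char_mul_char_eq h.choose_spec]
  have hf0 : ∀ y ∉ bicoset B x, f y = 0 := fun y hy =>
    dif_neg fun ⟨p, hp⟩ => hy ⟨p.1, p.2, hp⟩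
  refine ⟨f, fun b b' y => ?_, by simpa using hf 1 1, hf0⟩
  by_cases hy : y ∈ bicoset B x
  · obtain ⟨c, c', rfl⟩ := hy
    have : (b : K) * (c * x * c') * b' = (b * c : B) * x * (c' * b' : B) := by simp [mul_assoc]
    rw [this, hf, hf]
    simp only [map_mul, Units.val_mul]
    ring
  · have hy' : (b : K) * y * b' ∉ bicoset B x := fun h =>
      hy (bicoset_subset_of_mem h (mem_bicoset_symm ⟨b, b', rfl⟩))
    rw [hf0 _ hy, hf0 _ hy']
    simp

lemma supports_of_hecke_ne_zero {f : K → ℂ} (hf : f ∈ hecke K B χ ψ) {x : K} (hx : f x ≠ 0) :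
    Supports χ ψ x := by
  intro b b' h
  have h1 := hf b b' x
  rw [h] at h1
  refine Units.ext (mul_right_cancel₀ hx ?_)
  rw [Units.val_mul, Units.val_one]
  linear_combination -h1

/-- Evaluation of elements of `H(χ, ψ)` at representatives of the supporting double cosets. -/
def heckeEval (χ ψ : B →* ℂˣ) : hecke K B χ ψ →ₗ[ℂ] (supportingBicosets χ ψ → ℂ) where
  toFun f s := f.1 s.2.choose
  map_add' _ _ := rfl
  map_smul' _ _ := rfl

lemma heckeEval_injective : Function.Injective (heckeEval χ ψ) := by
  rw [← LinearMap.ker_eq_bot, LinearMap.ker_eq_bot']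
  intro f hf
  ext x
  by_contra hx
  have hs : bicoset B x ∈ supportingBicosets χ ψ := ⟨x, supports_of_hecke_ne_zero f.2 hx, rfl⟩
  have hx' : x ∈ bicoset B hs.choose := hs.choose_spec.2 ▸ mem_bicoset_self x
  obtain ⟨b, b', h⟩ := hx'
  have h0 : f.1 hs.choose = 0 := congrFun hf ⟨_, hs⟩
  apply hx
  rw [h, f.2, h0]
  simp

lemma heckeEval_surjective [Finite (supportingBicosets χ ψ)] :
    Function.Surjective (heckeEval χ ψ) := by
  classical
  have := Fintype.ofFinite (supportingBicosets χ ψ)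
  choose f hf hf1 hf0 using fun s : supportingBicosets χ ψ => s.2.choose_spec.1.exists_hecke
  intro c
  refine ⟨∑ s, c s • ⟨f s, hf s⟩, ?_⟩
  ext t
  rw [map_sum, Finset.sum_apply, Finset.sum_eq_single t]
  · change c t * f t t.2.choose = c t
    rw [hf1, mul_one]
  · intro s _ hst
    change c s * f s t.2.choose = 0
    rw [hf0, mul_zero]
    intro h
    refine hst (Subtype.ext ?_)
    rw [s.2.choose_spec.2, t.2.choose_spec.2, bicoset_eq_of_mem h]
  · simp

lemma finrank_hecke [Finite (K ⧸ B)] (χ ψ : B →* ℂˣ) :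
    Module.finrank ℂ (hecke K B χ ψ) = Nat.card (supportingBicosets χ ψ) := by
  have := finite_supportingBicosets χ ψ
  have := Fintype.ofFinite (supportingBicosets χ ψ)
  rw [(LinearEquiv.ofBijective (heckeEval χ ψ)
      ⟨heckeEval_injective, heckeEval_surjective⟩).finrank_eq,
    Module.finrank_fintype_fun_eq_card, Nat.card_eq_fintype_card]

end IntertwinerHecke

/-- **Statement 14.** Let `K` be a group, `B` a subgroup of finite index, and
`χ, ψ : B → ℂˣ` homomorphisms. Then the dimension of the space of `K`-equivariant linear
maps `V_χ → V_ψ` equals the dimension of the Hecke space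
`H(χ, ψ) = {f : K → ℂ | f(b g b') = χ(b) f(g) ψ(b')}`, and this common dimension equals the
number of double cosets `BxB` in `B\K/B` such that `χ(g) = ψ(x g x⁻¹)` for all `g ∈ B` with
`x g x⁻¹ ∈ B`. -/
theorem hom_space_dim_eq_hecke_dim (K : Type) [Group K] (B : Subgroup K) (hB : B.index ≠ 0)
    (χ ψ : B →* ℂˣ) :
    Module.finrank ℂ ↥(homK K B χ ψ) = Module.finrank ℂ ↥(hecke K B χ ψ) ∧
    Module.finrank ℂ ↥(hecke K B χ ψ) =
      Nat.card ↥{s : Set K | ∃ x : K,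
        (∀ (g : K) (hg : g ∈ B) (hx : x * g * x⁻¹ ∈ B), χ ⟨g, hg⟩ = ψ ⟨x * g * x⁻¹, hx⟩) ∧
        s = {y : K | ∃ b b' : B, y = ↑b * x * ↑b'}} := by
  have : B.FiniteIndex := ⟨hB⟩
  have := Fintype.ofFinite (K ⧸ B)
  refine ⟨?_, ?_⟩
  · rw [(homKEquivHecke χ ψ).finrank_eq, finrank_hecke, finrank_hecke,
      card_supportingBicosets_comm]
  · rw [finrank_hecke, card_supportingBicosets_comm]
    simp only [supportingBicosets, supports_iff_conj, bicoset]
end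
end
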